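/- Let K = (K_n)_{n≥1} be a matrix convex set in V. If a convex subset F ⊆ K_r is a weak matrix exposed face of K, then for every invertible matrix γ ∈ M_r(ℂ) with tr(γ*γ) = 1, the set F_γ := {(γ*γ, γ*Aγ) : A ∈ F} is an exposed face of the convex set Γ_r(K) ⊆ M_r(ℂ) × M_r(V). -/

import Mathlib

open scoped Matrix Kronecker ComplexOrder

noncomputable section

variable {V : Type*} [AddCommGroup V] [Module ℂ V]

/-- The matrix `γ* A γ` computed entrywise via the `ℂ`-action on `V`. -/
def mconj {m n : ℕ} (γ : Matrix (Fin m) (Fin n) ℂ)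
    (A : Matrix (Fin m) (Fin m) V) : Matrix (Fin n) (Fin n) V :=
  Matrix.of fun i j => ∑ k, ∑ l, (star (γ k i) * γ l j) • A k l

/-- A graded family `K = (K_n)` is a matrix convex set. -/
def IsMatrixConvex (K : ∀ n : ℕ, Set (Matrix (Fin n) (Fin n) V)) : Prop :=
  ∀ (k n : ℕ), 0 < k → 0 < n →
    ∀ (ns : Fin k → ℕ) (A : ∀ i : Fin k, Matrix (Fin (ns i)) (Fin (ns i)) V)
      (γ : ∀ i : Fin k, Matrix (Fin (ns i)) (Fin n) ℂ),
      (∀ i, 0 < ns i) → (∀ i, A i ∈ K (ns i)) →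
      (∑ i, (γ i)ᴴ * γ i) = 1 →
      (∑ i, mconj (γ i) (A i)) ∈ K n

/-- The `r`-th ampliation of `Φ : V → M_m(ℂ)` applied to `B ∈ M_r(V)`, as a matrix
indexed by `Fin m × Fin r` (block `(i,j)`, inner indices `(p,q)` ↦ `Φ (B i j) p q`). -/
def amplify {m r : ℕ} (Φ : V → Matrix (Fin m) (Fin m) ℂ)
    (B : Matrix (Fin r) (Fin r) V) : Matrix (Fin m × Fin r) (Fin m × Fin r) ℂ :=
  Matrix.of fun p q => Φ (B p.2 q.2) p.1 q.1

/-- Hermitian part `(X + X*)/2` of a complex matrix. -/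
def reM {ι : Type*} (X : Matrix ι ι ℂ) : Matrix ι ι ℂ := (2 : ℂ)⁻¹ • (X + Xᴴ)

section Top

variable [TopologicalSpace V]

/-- `(Φ, α)` matricially exposes the point `A ∈ K_n`. -/
def IsExposingPair (K : ∀ n : ℕ, Set (Matrix (Fin n) (Fin n) V)) {n : ℕ}
    (A : Matrix (Fin n) (Fin n) V)
    (Φ : V →L[ℂ] Matrix (Fin n) (Fin n) ℂ) (α : Matrix (Fin n) (Fin n) ℂ) : Prop :=
  α.IsHermitian ∧
  (∀ r : ℕ, 0 < r → ∀ B ∈ K r,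
    (α ⊗ₖ (1 : Matrix (Fin r) (Fin r) ℂ) - reM (amplify (⇑Φ) B)).PosSemidef) ∧
  {B | B ∈ K n ∧
      (α ⊗ₖ (1 : Matrix (Fin n) (Fin n) ℂ) - reM (amplify (⇑Φ) B)).PosSemidef ∧
      ¬ IsUnit (α ⊗ₖ (1 : Matrix (Fin n) (Fin n) ℂ) - reM (amplify (⇑Φ) B))} =
    {B | ∃ U ∈ Matrix.unitaryGroup (Fin n) ℂ, B = mconj U A}

/-- `A ∈ K_n` is a matrix exposed point of `K`. -/
def IsMatrixExposed (K : ∀ n : ℕ, Set (Matrix (Fin n) (Fin n) V)) {n : ℕ}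
    (A : Matrix (Fin n) (Fin n) V) : Prop :=
  ∃ (Φ : V →L[ℂ] Matrix (Fin n) (Fin n) ℂ) (α : Matrix (Fin n) (Fin n) ℂ),
    IsExposingPair K A Φ α

end Top

/-- Classical exposed point of a set in a topological `ℂ`-vector space. -/
def IsExposedPoint {W : Type*} [AddCommGroup W] [Module ℂ W] [TopologicalSpace W]
    (C : Set W) (x : W) : Prop :=
  x ∈ C ∧ ∃ (φ : W →L[ℂ] ℂ) (a : ℝ),
    (φ x).re = a ∧ ∀ y ∈ C, y ≠ x → (φ y).re < a

/-- Classical exposed face of a set in a topological `ℂ`-vector space. -/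
def IsExposedFaceOf {W : Type*} [AddCommGroup W] [Module ℂ W] [TopologicalSpace W]
    (C F : Set W) : Prop :=
  F ⊆ C ∧ ∃ (φ : W →L[ℂ] ℂ) (a : ℝ),
    (∀ x ∈ F, (φ x).re = a) ∧ ∀ y ∈ C, y ∉ F → (φ y).re < a

/-- `A ∈ K_n` is a matrix extreme point of the graded family `K`. -/
def IsMatrixExtreme (K : ∀ n : ℕ, Set (Matrix (Fin n) (Fin n) V)) {n : ℕ}
    (A : Matrix (Fin n) (Fin n) V) : Prop :=
  A ∈ K n ∧
  ∀ (k : ℕ), 0 < k →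
    ∀ (ns : Fin k → ℕ) (Ai : ∀ i : Fin k, Matrix (Fin (ns i)) (Fin (ns i)) V)
      (γ : ∀ i : Fin k, Matrix (Fin (ns i)) (Fin n) ℂ),
      (∀ i, 0 < ns i) → (∀ i, Ai i ∈ K (ns i)) →
      (∀ i, Function.Surjective (γ i).mulVec) →
      (∑ i, (γ i)ᴴ * γ i) = 1 →
      (∑ i, mconj (γ i) (Ai i)) = A →
      ∀ i, ∃ (h : ns i = n) (U : Matrix (Fin n) (Fin n) ℂ),
        U ∈ Matrix.unitaryGroup (Fin n) ℂ ∧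
        Matrix.reindex (finCongr h) (finCongr h) (Ai i) = mconj U A

/-- `Γ_n(K)`. -/
def GammaSet (K : ∀ n : ℕ, Set (Matrix (Fin n) (Fin n) V)) (n : ℕ) :
    Set (Matrix (Fin n) (Fin n) ℂ × Matrix (Fin n) (Fin n) V) :=
  {P | ∃ (k : ℕ), 0 < k ∧ ∃ (A : Matrix (Fin k) (Fin k) V) (γ : Matrix (Fin k) (Fin n) ℂ),
    A ∈ K k ∧ (γᴴ * γ).trace = 1 ∧ P = (γᴴ * γ, mconj γ A)}

/-- Matrix face `F ⊆ K_n`. -/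
def IsMatrixFace (K : ∀ n : ℕ, Set (Matrix (Fin n) (Fin n) V)) {n : ℕ}
    (F : Set (Matrix (Fin n) (Fin n) V)) : Prop :=
  F ⊆ K n ∧ Convex ℝ F ∧
  ∀ (k : ℕ), 0 < k →
    ∀ (ns : Fin k → ℕ) (Ai : ∀ i : Fin k, Matrix (Fin (ns i)) (Fin (ns i)) V)
      (γ : ∀ i : Fin k, Matrix (Fin (ns i)) (Fin n) ℂ),
      (∀ i, 0 < ns i) → (∀ i, Ai i ∈ K (ns i)) →
      (∀ i, Function.Surjective (γ i).mulVec) →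
      (∑ i, (γ i)ᴴ * γ i) = 1 →
      (∑ i, mconj (γ i) (Ai i)) ∈ F →
      ∀ i, ∃ h : ns i = n, Matrix.reindex (finCongr h) (finCongr h) (Ai i) ∈ F

/-- `A` is a `C*`-extreme point of `F ⊆ M_n(V)`. -/
def IsCStarExtreme {n : ℕ} (F : Set (Matrix (Fin n) (Fin n) V))
    (A : Matrix (Fin n) (Fin n) V) : Prop :=
  A ∈ F ∧
  ∀ (k : ℕ), 0 < k →
    ∀ (Ai : Fin k → Matrix (Fin n) (Fin n) V) (γ : Fin k → Matrix (Fin n) (Fin n) ℂ),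
      (∀ i, Ai i ∈ F) → (∀ i, IsUnit (γ i)) →
      (∑ i, (γ i)ᴴ * γ i) = 1 →
      (∑ i, mconj (γ i) (Ai i)) = A →
      ∀ i, ∃ U ∈ Matrix.unitaryGroup (Fin n) ℂ, Ai i = mconj U A

section Top2

variable [TopologicalSpace V]

/-- `(Φ, α)` is an exposing pair for the face `F ⊆ K_n`. -/
def IsFaceExposingPair (K : ∀ n : ℕ, Set (Matrix (Fin n) (Fin n) V)) {n : ℕ}
    (F : Set (Matrix (Fin n) (Fin n) V))
    (Φ : V →L[ℂ] Matrix (Fin n) (Fin n) ℂ) (α : Matrix (Fin n) (Fin n) ℂ) : Prop :=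
  α.IsHermitian ∧
  (∀ m : ℕ, 0 < m → ∀ B ∈ K m,
    (α ⊗ₖ (1 : Matrix (Fin m) (Fin m) ℂ) - reM (amplify (⇑Φ) B)).PosSemidef) ∧
  (∀ m : ℕ, 0 < m → m < n → ∀ B ∈ K m,
    (α ⊗ₖ (1 : Matrix (Fin m) (Fin m) ℂ) - reM (amplify (⇑Φ) B)).PosDef) ∧
  {B | B ∈ K n ∧
      (α ⊗ₖ (1 : Matrix (Fin n) (Fin n) ℂ) - reM (amplify (⇑Φ) B)).PosSemidef ∧
      ¬ IsUnit (α ⊗ₖ (1 : Matrix (Fin n) (Fin n) ℂ) - reM (amplify (⇑Φ) B))} = F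

/-- `F ⊆ K_n` is a matrix exposed face of `K`. -/
def IsMatrixExposedFace (K : ∀ n : ℕ, Set (Matrix (Fin n) (Fin n) V)) {n : ℕ}
    (F : Set (Matrix (Fin n) (Fin n) V)) : Prop :=
  F ⊆ K n ∧ Convex ℝ F ∧
  ∃ (Φ : V →L[ℂ] Matrix (Fin n) (Fin n) ℂ) (α : Matrix (Fin n) (Fin n) ℂ),
    IsFaceExposingPair K F Φ α

/-- The unitary orbit of `F ⊆ M_n(V)`. -/
def unitaryOrbit {n : ℕ} (F : Set (Matrix (Fin n) (Fin n) V)) :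
    Set (Matrix (Fin n) (Fin n) V) :=
  {B | ∃ A ∈ F, ∃ U ∈ Matrix.unitaryGroup (Fin n) ℂ, B = mconj U A}

/-- `F ⊆ K_n` is a weak matrix exposed face of `K`. -/
def IsWeakMatrixExposedFace (K : ∀ n : ℕ, Set (Matrix (Fin n) (Fin n) V)) {n : ℕ}
    (F : Set (Matrix (Fin n) (Fin n) V)) : Prop :=
  F ⊆ K n ∧ Convex ℝ F ∧
  ∃ (Φ : V →L[ℂ] Matrix (Fin n) (Fin n) ℂ) (α : Matrix (Fin n) (Fin n) ℂ),
    α.IsHermitian ∧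
    (∀ m : ℕ, 0 < m → ∀ B ∈ K m,
      (α ⊗ₖ (1 : Matrix (Fin m) (Fin m) ℂ) - reM (amplify (⇑Φ) B)).PosSemidef) ∧
    (∀ m : ℕ, 0 < m → m < n → ∀ B ∈ K m,
      (α ⊗ₖ (1 : Matrix (Fin m) (Fin m) ℂ) - reM (amplify (⇑Φ) B)).PosDef) ∧
    {B | B ∈ K n ∧
        (α ⊗ₖ (1 : Matrix (Fin n) (Fin n) ℂ) - reM (amplify (⇑Φ) B)).PosSemidef ∧
        ¬ IsUnit (α ⊗ₖ (1 : Matrix (Fin n) (Fin n) ℂ) - reM (amplify (⇑Φ) B))} =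
      unitaryOrbit F

end Top2

/-- `F = (F_n)` is a matrix multiface of `K`. -/
def IsMatrixMultiface (K F : ∀ n : ℕ, Set (Matrix (Fin n) (Fin n) V)) : Prop :=
  (∀ n, F n ⊆ K n) ∧ (∀ n, Convex ℝ (F n)) ∧
  ∀ (k n : ℕ), 0 < k → 0 < n →
    ∀ (ns : Fin k → ℕ) (Ai : ∀ i : Fin k, Matrix (Fin (ns i)) (Fin (ns i)) V)
      (γ : ∀ i : Fin k, Matrix (Fin (ns i)) (Fin n) ℂ),
      (∀ i, 0 < ns i) → (∀ i, Ai i ∈ K (ns i)) →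
      (∀ i, Function.Surjective (γ i).mulVec) →
      (∑ i, (γ i)ᴴ * γ i) = 1 →
      (∑ i, mconj (γ i) (Ai i)) ∈ F n →
      ∀ i, Ai i ∈ F (ns i)

section Top3

variable [TopologicalSpace V]

/-- `F = (F_n)` is a matrix exposed multiface of `K`. -/
def IsMatrixExposedMultiface (K F : ∀ n : ℕ, Set (Matrix (Fin n) (Fin n) V)) : Prop :=
  (∀ n, F n ⊆ K n) ∧ (∀ n, Convex ℝ (F n)) ∧
  ∃ (r : ℕ), 0 < r ∧
    ∃ (Φ : V →L[ℂ] Matrix (Fin r) (Fin r) ℂ) (α : Matrix (Fin r) (Fin r) ℂ),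
      α.IsHermitian ∧
      (∀ n : ℕ, 0 < n → ∀ B ∈ K n,
        (α ⊗ₖ (1 : Matrix (Fin n) (Fin n) ℂ) - reM (amplify (⇑Φ) B)).PosSemidef) ∧
      (∀ n : ℕ, 0 < n →
        {B | B ∈ K n ∧
            (α ⊗ₖ (1 : Matrix (Fin n) (Fin n) ℂ) - reM (amplify (⇑Φ) B)).PosSemidef ∧
            ¬ IsUnit (α ⊗ₖ (1 : Matrix (Fin n) (Fin n) ℂ) - reM (amplify (⇑Φ) B))} = F n)

end Top3

end

section Helpers

variable {V : Type*} [AddCommGroup V] [Module ℂ V]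

theorem mconj_mul {k m n : ℕ} (γ : Matrix (Fin k) (Fin m) ℂ) (δ : Matrix (Fin m) (Fin n) ℂ)
    (A : Matrix (Fin k) (Fin k) V) : mconj (γ * δ) A = mconj δ (mconj γ A) := by
  ext i j
  simp only [mconj, Matrix.of_apply, Matrix.mul_apply, star_sum, Finset.sum_mul_sum,
    Finset.sum_smul, Finset.smul_sum, smul_smul]
  have : ∀ (x y : Fin k) (a b : Fin m),
      (star (γ x a * δ a i) * (γ y b * δ b j)) • A x y =
        (star (δ a i) * δ b j * (star (γ x a) * γ y b)) • A x y := by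
    intro x y a b
    congr 1
    rw [star_mul']
    ring
  simp only [this]
  rw [Finset.sum_congr rfl fun x _ => Finset.sum_comm, Finset.sum_comm]
  refine Finset.sum_congr rfl fun a _ => ?_
  rw [Finset.sum_congr rfl fun x _ => Finset.sum_comm, Finset.sum_comm]

theorem mconj_one {n : ℕ} (A : Matrix (Fin n) (Fin n) V) : mconj 1 A = A := by
  ext i j
  simp [mconj, Matrix.one_apply, ite_smul]

theorem mconj_smul_of_norm_one {m n : ℕ} (c : ℂ) (hc : star c * c = 1)
    (γ : Matrix (Fin m) (Fin n) ℂ) (A : Matrix (Fin m) (Fin m) V) :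
    mconj (c • γ) A = mconj γ A := by
  ext i j
  simp only [mconj, Matrix.of_apply, Matrix.smul_apply, smul_eq_mul, star_mul']
  refine Finset.sum_congr rfl fun k _ => Finset.sum_congr rfl fun l _ => ?_
  rw [mul_mul_mul_comm, hc, one_mul]

/-- A matrix of rank `s` factors through an isometry from `ℂ^s`. -/
theorem exists_isometry_factorization {k n s : ℕ} (δ : Matrix (Fin k) (Fin n) ℂ)
    (hs : δ.rank = s) : ∃ (W : Matrix (Fin k) (Fin s) ℂ) (δ' : Matrix (Fin s) (Fin n) ℂ),
      Wᴴ * W = 1 ∧ δ = W * δ' := by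
  let R := LinearMap.range (Matrix.toEuclideanLin δ)
  have hR : Module.finrank ℂ R = s := by
    rw [← hs, Matrix.rank_eq_finrank_range_toLin δ (EuclideanSpace.basisFun (Fin k) ℂ).toBasis
      (EuclideanSpace.basisFun (Fin n) ℂ).toBasis, ← Matrix.toEuclideanLin_eq_toLin_orthonormal]
  let b : OrthonormalBasis (Fin s) ℂ R := (stdOrthonormalBasis ℂ R).reindex (finCongr hR)
  let W : Matrix (Fin k) (Fin s) ℂ := Matrix.of fun i j => (b j : EuclideanSpace ℂ (Fin k)) i
  refine ⟨W, Wᴴ * δ, ?_, ?_⟩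
  · ext i j
    have h := orthonormal_iff_ite.mp b.orthonormal i j
    rw [Submodule.coe_inner, PiLp.inner_apply] at h
    simp only [Matrix.mul_apply, Matrix.conjTranspose_apply, Matrix.one_apply, W, Matrix.of_apply]
    rw [← h]
    exact Finset.sum_congr rfl fun x _ => by simp [mul_comm]
  · ext i j
    let v : R := ⟨Matrix.toEuclideanLin δ (EuclideanSpace.single j 1), LinearMap.mem_range_self _ _⟩
    have hv : ∀ x, (v : EuclideanSpace ℂ (Fin k)) x = δ x j := by
      intro x
      simp [v, Matrix.toLpLin_apply]
    have h := congrArg (fun w : R => (w : EuclideanSpace ℂ (Fin k)) i) (b.sum_repr' v)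
    simp only [Submodule.coe_sum, Submodule.coe_smul, Submodule.coe_inner, PiLp.inner_apply] at h
    rw [hv] at h
    rw [← h]
    simp only [Matrix.mul_apply, Matrix.conjTranspose_apply, W, Matrix.of_apply]
    simp [hv, mul_comm]

theorem IsMatrixConvex.mconj_mem {K : ∀ n : ℕ, Set (Matrix (Fin n) (Fin n) V)}
    (hK : IsMatrixConvex K) {m n : ℕ} (hm : 0 < m) (hn : 0 < n) {A : Matrix (Fin m) (Fin m) V}
    (hA : A ∈ K m) {W : Matrix (Fin m) (Fin n) ℂ} (hW : Wᴴ * W = 1) : mconj W A ∈ K n := by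
  simpa using hK 1 n one_pos hn (fun _ => m) (fun _ => A) (fun _ => W) (fun _ => hm) (fun _ => hA)
    (by simpa using hW)

/-- The linear form `(S, T) ↦ ∑ α_{pq} S_{pq} - ∑ Φ(T_{pq})_{pq}` attached to the pencil
`α ⊗ 1 - Φ`. -/
noncomputable def pencilForm {r : ℕ} (α : Matrix (Fin r) (Fin r) ℂ)
    (Φ : V →ₗ[ℂ] Matrix (Fin r) (Fin r) ℂ) :
    Matrix (Fin r) (Fin r) ℂ × Matrix (Fin r) (Fin r) V →ₗ[ℂ] ℂ where
  toFun P := ∑ p, ∑ q, α p q * P.1 p q - ∑ p, ∑ q, Φ (P.2 p q) p q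
  map_add' P Q := by
    simp only [Prod.fst_add, Prod.snd_add, Matrix.add_apply, map_add, mul_add,
      Finset.sum_add_distrib]
    ring
  map_smul' c P := by
    simp only [Prod.smul_fst, Prod.smul_snd, Matrix.smul_apply, map_smul, smul_eq_mul,
      RingHom.id_apply, mul_sub, Finset.mul_sum]
    simp only [mul_left_comm]

/-- The value of the Hermitian pencil at `B` on the vector `vec Y`. -/
noncomputable def pencilValue {r k : ℕ} (α : Matrix (Fin r) (Fin r) ℂ)
    (Φ : V →ₗ[ℂ] Matrix (Fin r) (Fin r) ℂ) (B : Matrix (Fin k) (Fin k) V)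
    (Y : Matrix (Fin k) (Fin r) ℂ) : ℝ :=
  (pencilForm α Φ (Yᴴ * Y, mconj Y B)).re

/-- The Hermitian pencil `α ⊗ 1 - Re Φ(B)`. -/
noncomputable def pencil {r k : ℕ} (α : Matrix (Fin r) (Fin r) ℂ)
    (Φ : V →ₗ[ℂ] Matrix (Fin r) (Fin r) ℂ) (B : Matrix (Fin k) (Fin k) V) :
    Matrix (Fin r × Fin k) (Fin r × Fin k) ℂ :=
  α ⊗ₖ (1 : Matrix (Fin k) (Fin k) ℂ) - reM (amplify (⇑Φ) B)

theorem re_dotProduct_reM {ι : Type*} [Fintype ι] (M : Matrix ι ι ℂ) (y : ι → ℂ) :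
    (star y ⬝ᵥ reM M *ᵥ y).re = (star y ⬝ᵥ M *ᵥ y).re := by
  have h : star y ⬝ᵥ Mᴴ *ᵥ y = star (star y ⬝ᵥ M *ᵥ y) := by
    rw [← Matrix.star_dotProduct, Matrix.star_mulVec, Matrix.dotProduct_mulVec]
  rw [reM, Matrix.smul_mulVec, dotProduct_smul, Matrix.add_mulVec, dotProduct_add, h]
  simp
  ring

theorem re_dotProduct_pencil {r k : ℕ} (α : Matrix (Fin r) (Fin r) ℂ)
    (Φ : V →ₗ[ℂ] Matrix (Fin r) (Fin r) ℂ) (B : Matrix (Fin k) (Fin k) V)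
    (Y : Matrix (Fin k) (Fin r) ℂ) :
    (star Y.vec ⬝ᵥ pencil α Φ B *ᵥ Y.vec).re = pencilValue α Φ B Y := by
  rw [pencil, Matrix.sub_mulVec, dotProduct_sub, Complex.sub_re, re_dotProduct_reM,
    ← Complex.sub_re, pencilValue]
  congr 1
  simp only [pencilForm, LinearMap.coe_mk, AddHom.coe_mk]
  congr 1
  · simp only [dotProduct, Matrix.mulVec, Fintype.sum_prod_type, Matrix.vec,
      Matrix.kroneckerMap_apply, Matrix.one_apply, Pi.star_apply, Matrix.mul_apply,
      Matrix.conjTranspose_apply, Finset.mul_sum]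
    refine Finset.sum_congr rfl fun p _ => ?_
    rw [Finset.sum_comm]
    refine Finset.sum_congr rfl fun q _ => Finset.sum_congr rfl fun i _ => ?_
    simp
    ring
  · simp only [dotProduct, Matrix.mulVec, Fintype.sum_prod_type, Matrix.vec, amplify, mconj,
      Pi.star_apply, Matrix.of_apply, map_sum, map_smul, Matrix.sum_apply, Matrix.smul_apply,
      smul_eq_mul, Finset.mul_sum]
    refine Finset.sum_congr rfl fun p _ => ?_
    rw [Finset.sum_comm]
    refine Finset.sum_congr rfl fun q _ => Finset.sum_congr rfl fun i _ =>
      Finset.sum_congr rfl fun j _ => ?_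
    ring

theorem pencilValue_mul {r k s : ℕ} (α : Matrix (Fin r) (Fin r) ℂ)
    (Φ : V →ₗ[ℂ] Matrix (Fin r) (Fin r) ℂ) (B : Matrix (Fin k) (Fin k) V)
    {W : Matrix (Fin k) (Fin s) ℂ} (hW : Wᴴ * W = 1) (Y : Matrix (Fin s) (Fin r) ℂ) :
    pencilValue α Φ B (W * Y) = pencilValue α Φ (mconj W B) Y := by
  rw [pencilValue, pencilValue, mconj_mul, Matrix.conjTranspose_mul, Matrix.mul_assoc,
    ← Matrix.mul_assoc Wᴴ, hW, Matrix.one_mul]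

theorem pencilValue_convexComb {r k : ℕ} (α : Matrix (Fin r) (Fin r) ℂ)
    (Φ : V →ₗ[ℂ] Matrix (Fin r) (Fin r) ℂ) (A B : Matrix (Fin k) (Fin k) V)
    (Y : Matrix (Fin k) (Fin r) ℂ) {s t : ℝ} (hst : s + t = 1) :
    pencilValue α Φ (s • A + t • B) Y =
      s * pencilValue α Φ A Y + t * pencilValue α Φ B Y := by
  have h : (Yᴴ * Y, mconj Y (s • A + t • B)) =
      (s : ℂ) • (Yᴴ * Y, mconj Y A) + (t : ℂ) • (Yᴴ * Y, mconj Y B) := by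
    refine Prod.ext ?_ ?_
    · simp only [Prod.fst_add, Prod.smul_fst, ← add_smul, ← Complex.ofReal_add, hst,
        Complex.ofReal_one, one_smul]
    · ext i j
      simp only [Prod.snd_add, Prod.smul_snd, Matrix.add_apply, Matrix.smul_apply, mconj,
        Matrix.of_apply, Finset.smul_sum, ← Finset.sum_add_distrib, smul_add]
      refine Finset.sum_congr rfl fun a _ => Finset.sum_congr rfl fun b _ => ?_
      rw [← Complex.coe_smul, ← Complex.coe_smul, smul_comm (s : ℂ), smul_comm (t : ℂ)]
  rw [pencilValue, h, map_add, map_smul, map_smul]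
  simp [pencilValue]

theorem pencilValue_nonneg {r k : ℕ} {α : Matrix (Fin r) (Fin r) ℂ}
    {Φ : V →ₗ[ℂ] Matrix (Fin r) (Fin r) ℂ} {B : Matrix (Fin k) (Fin k) V}
    (h : (pencil α Φ B).PosSemidef) (Y : Matrix (Fin k) (Fin r) ℂ) :
    0 ≤ pencilValue α Φ B Y := by
  rw [← re_dotProduct_pencil]
  exact h.re_dotProduct_nonneg _

theorem pencilValue_pos {r k : ℕ} {α : Matrix (Fin r) (Fin r) ℂ}
    {Φ : V →ₗ[ℂ] Matrix (Fin r) (Fin r) ℂ} {B : Matrix (Fin k) (Fin k) V}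
    (h : (pencil α Φ B).PosDef) {Y : Matrix (Fin k) (Fin r) ℂ} (hY : Y ≠ 0) :
    0 < pencilValue α Φ B Y := by
  rw [← re_dotProduct_pencil]
  exact h.re_dotProduct_pos (by simpa using hY)

theorem pencilValue_eq_zero_iff {r k : ℕ} {α : Matrix (Fin r) (Fin r) ℂ}
    {Φ : V →ₗ[ℂ] Matrix (Fin r) (Fin r) ℂ} {B : Matrix (Fin k) (Fin k) V}
    (h : (pencil α Φ B).PosSemidef) (Y : Matrix (Fin k) (Fin r) ℂ) :
    pencilValue α Φ B Y = 0 ↔ pencil α Φ B *ᵥ Y.vec = 0 := by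
  rw [← re_dotProduct_pencil, ← h.dotProduct_mulVec_zero_iff]
  have h0 := h.dotProduct_mulVec_nonneg Y.vec
  rw [Complex.le_def] at h0
  rw [Complex.ext_iff]
  simp [← h0.2]

theorem not_isUnit_iff_exists_vec {r k : ℕ} (M : Matrix (Fin r × Fin k) (Fin r × Fin k) ℂ) :
    ¬ IsUnit M ↔ ∃ Y : Matrix (Fin k) (Fin r) ℂ, Y ≠ 0 ∧ M *ᵥ Y.vec = 0 := by
  rw [Matrix.isUnit_iff_isUnit_det, isUnit_iff_ne_zero, not_not,
    ← Matrix.exists_mulVec_eq_zero_iff]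
  constructor
  · rintro ⟨v, hv, h⟩
    refine ⟨Matrix.of fun i p => v (p, i), fun h0 => hv ?_, h⟩
    ext ⟨p, i⟩
    exact congrFun (congrFun h0 i) p
  · rintro ⟨Y, hY, h⟩
    exact ⟨Y.vec, by simpa using hY, h⟩

section

variable {K : ∀ n : ℕ, Set (Matrix (Fin n) (Fin n) V)} {r : ℕ}
  {α : Matrix (Fin r) (Fin r) ℂ} {Φ : V →ₗ[ℂ] Matrix (Fin r) (Fin r) ℂ}

theorem rank_eq_of_pencilValue_eq_zero (hK : IsMatrixConvex K)
    (hpos : ∀ m : ℕ, 0 < m → m < r → ∀ B ∈ K m, (pencil α Φ B).PosDef)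
    {k : ℕ} (hk : 0 < k) {B : Matrix (Fin k) (Fin k) V} (hB : B ∈ K k)
    {δ Z : Matrix (Fin k) (Fin r) ℂ} {Y : Matrix (Fin r) (Fin r) ℂ} (hZ : Z = δ * Y)
    (hZ0 : Z ≠ 0) (h : pencilValue α Φ B Z = 0) : δ.rank = r := by
  obtain ⟨W, δ', hW, hδ⟩ := exists_isometry_factorization δ rfl
  by_contra hne
  have hlt : δ.rank < r := lt_of_le_of_ne (by simpa using δ.rank_le_width) hne
  have hpos' : 0 < δ.rank := by
    rw [Nat.pos_iff_ne_zero]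
    intro h0
    obtain ⟨W₀, δ₀, -, hδ₀⟩ := exists_isometry_factorization δ h0
    have : δ = 0 := by
      ext i j
      simp [hδ₀]
    exact hZ0 (by rw [hZ, this, Matrix.zero_mul])
  have hZ' : Z = W * (δ' * Y) := by rw [hZ, ← Matrix.mul_assoc, ← hδ]
  have hne' : δ' * Y ≠ 0 := fun h0 => hZ0 (by rw [hZ', h0, Matrix.mul_zero])
  rw [hZ', pencilValue_mul α Φ B hW] at h
  exact (pencilValue_pos (hpos _ hpos' hlt _ (hK.mconj_mem hk hpos' hB hW)) hne').ne' h

theorem isUnit_of_rank_eq {Y : Matrix (Fin r) (Fin r) ℂ} (h : Y.rank = r) : IsUnit Y := by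
  rw [← Matrix.mulVec_surjective_iff_isUnit]
  have htop : LinearMap.range Y.mulVecLin = ⊤ :=
    Submodule.eq_top_of_finrank_eq (h.trans (by simp))
  exact LinearMap.range_eq_top.mp htop

theorem isUnit_of_pencilValue_eq_zero (hK : IsMatrixConvex K) (hr : 0 < r)
    (hpos : ∀ m : ℕ, 0 < m → m < r → ∀ B ∈ K m, (pencil α Φ B).PosDef)
    {B : Matrix (Fin r) (Fin r) V} (hB : B ∈ K r)
    {Y : Matrix (Fin r) (Fin r) ℂ} (hY : Y ≠ 0) (h : pencilValue α Φ B Y = 0) : IsUnit Y :=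
  isUnit_of_rank_eq
    (rank_eq_of_pencilValue_eq_zero hK hpos hr hB (Matrix.mul_one Y).symm hY h)

/-- The kernel of the pencil at a point of `K_r` is at most one-dimensional. -/
theorem exists_eq_smul_of_pencilValue_eq_zero (hK : IsMatrixConvex K) (hr : 0 < r)
    (hpos : ∀ m : ℕ, 0 < m → m < r → ∀ B ∈ K m, (pencil α Φ B).PosDef)
    {B : Matrix (Fin r) (Fin r) V} (hB : B ∈ K r) (hpsd : (pencil α Φ B).PosSemidef)
    {X Y : Matrix (Fin r) (Fin r) ℂ} (hX : IsUnit X) (hX0 : pencilValue α Φ B X = 0)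
    (hY0 : pencilValue α Φ B Y = 0) : ∃ c : ℂ, Y = c • X := by
  have : Nonempty (Fin r) := ⟨⟨0, hr⟩⟩
  have hdet := (Matrix.isUnit_iff_isUnit_det X).mp hX
  obtain ⟨c, hc⟩ := spectrum.nonempty_of_isAlgClosed_of_finiteDimensional ℂ (Y * X⁻¹)
  refine ⟨c, ?_⟩
  have h0 : pencilValue α Φ B (c • X - Y) = 0 := by
    rw [pencilValue_eq_zero_iff hpsd] at hX0 hY0 ⊢
    rw [Matrix.vec_sub, Matrix.vec_smul, Matrix.mulVec_sub, Matrix.mulVec_smul, hX0, hY0]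
    simp
  by_contra hne
  have hu := isUnit_of_pencilValue_eq_zero hK hr hpos hB
    (fun h => hne (sub_eq_zero.mp h).symm) h0
  apply hc
  have : algebraMap ℂ _ c - Y * X⁻¹ = (c • X - Y) * X⁻¹ := by
    rw [Matrix.sub_mul, Matrix.smul_mul, Matrix.mul_nonsing_inv X hdet,
      Algebra.algebraMap_eq_smul_one]
  rw [spectrum.mem_resolventSet_iff, this]
  exact hu.mul (by simpa using hX)

theorem exists_common_kernel (hK : IsMatrixConvex K) (hr : 0 < r)
    (hpos : ∀ m : ℕ, 0 < m → m < r → ∀ B ∈ K m, (pencil α Φ B).PosDef)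
    {F : Set (Matrix (Fin r) (Fin r) V)} (hFK : F ⊆ K r) (hconv : Convex ℝ F)
    (hpsd : ∀ A ∈ K r, (pencil α Φ A).PosSemidef)
    (hker : ∀ A ∈ F, ∃ Y : Matrix (Fin r) (Fin r) ℂ, Y ≠ 0 ∧ pencilValue α Φ A Y = 0) :
    ∃ X : Matrix (Fin r) (Fin r) ℂ, IsUnit X ∧ ∀ A ∈ F, pencilValue α Φ A X = 0 := by
  rcases F.eq_empty_or_nonempty with rfl | ⟨A₀, hA₀⟩
  · exact ⟨1, isUnit_one, by simp⟩
  obtain ⟨X, hX, hX0⟩ := hker A₀ hA₀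
  have hXu := isUnit_of_pencilValue_eq_zero hK hr hpos (hFK hA₀) hX hX0
  refine ⟨X, hXu, fun A hA => ?_⟩
  have hhalf : (1 / 2 : ℝ) + 1 / 2 = 1 := by norm_num
  obtain ⟨Y, hY, hY0⟩ := hker _ (hconv hA₀ hA (by norm_num) (by norm_num) hhalf)
  rw [pencilValue_convexComb α Φ A₀ A Y hhalf] at hY0
  have h1 := pencilValue_nonneg (hpsd A₀ (hFK hA₀)) Y
  have h2 := pencilValue_nonneg (hpsd A (hFK hA)) Y
  have h3 : pencilValue α Φ A₀ Y = 0 := by linarith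
  have h4 : pencilValue α Φ A Y = 0 := by linarith
  obtain ⟨c, rfl⟩ := exists_eq_smul_of_pencilValue_eq_zero hK hr hpos (hFK hA₀)
    (hpsd A₀ (hFK hA₀)) hXu hX0 h3
  have hc : c ≠ 0 := by
    rintro rfl
    simp at hY
  rw [pencilValue_eq_zero_iff (hpsd A (hFK hA)), Matrix.vec_smul, Matrix.mulVec_smul,
    smul_eq_zero] at h4
  rw [pencilValue_eq_zero_iff (hpsd A (hFK hA))]
  exact h4.resolve_left hc

/-- If the pencil at `B` vanishes at `δ * Z`, where `X = γ * Z` spans its kernel on `F`, then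
`(δ*δ, δ*Bδ)` is of the form `(γ*γ, γ*Aγ)` with `A ∈ F`. -/
theorem mem_image_of_pencilValue_eq_zero (hK : IsMatrixConvex K) (hr : 0 < r)
    (hpos : ∀ m : ℕ, 0 < m → m < r → ∀ B ∈ K m, (pencil α Φ B).PosDef)
    {F : Set (Matrix (Fin r) (Fin r) V)} (hFK : F ⊆ K r)
    (hpsd : ∀ A ∈ K r, (pencil α Φ A).PosSemidef)
    (hexp : ∀ B ∈ K r, (∃ Y : Matrix (Fin r) (Fin r) ℂ, Y ≠ 0 ∧ pencilValue α Φ B Y = 0) →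
      B ∈ unitaryOrbit F)
    {γ Z : Matrix (Fin r) (Fin r) ℂ} (htr : (γᴴ * γ).trace = 1) (hγ : IsUnit γ) (hZ : IsUnit Z)
    (hker : ∀ A ∈ F, pencilValue α Φ A (γ * Z) = 0)
    {k : ℕ} (hk : 0 < k) {B : Matrix (Fin k) (Fin k) V} (hB : B ∈ K k)
    {δ : Matrix (Fin k) (Fin r) ℂ} (hδ : (δᴴ * δ).trace = 1)
    (h : pencilValue α Φ B (δ * Z) = 0) :
    (δᴴ * δ, mconj δ B) ∈ (fun A => (γᴴ * γ, mconj γ A)) '' F := by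
  have cancel : ∀ {l : ℕ} {S T : Matrix (Fin l) (Fin r) ℂ}, S * Z = T * Z → S = T := by
    intro l S T hST
    have hdet := (Matrix.isUnit_iff_isUnit_det Z).mp hZ
    rw [← Matrix.mul_nonsing_inv_cancel_right Z S hdet, hST,
      Matrix.mul_nonsing_inv_cancel_right Z T hdet]
  have hne : δ * Z ≠ 0 := by
    intro h0
    have hδ0 : δ = 0 := cancel (by rw [h0, Matrix.zero_mul])
    simp [hδ0] at hδ
  obtain ⟨W, δ', hW, rfl⟩ := exists_isometry_factorization δ
    (rank_eq_of_pencilValue_eq_zero hK hpos hk hB rfl hne h)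
  rw [Matrix.mul_assoc] at hne
  rw [Matrix.mul_assoc, pencilValue_mul α Φ B hW] at h
  have hne' : δ' * Z ≠ 0 := fun h0 => hne (by rw [h0, Matrix.mul_zero])
  obtain ⟨A, hA, U, hU, hBA⟩ := hexp _ (hK.mconj_mem hk hr hB hW) ⟨_, hne', h⟩
  have hU' : Uᴴ * U = 1 := Matrix.mem_unitaryGroup_iff'.mp hU
  rw [hBA, ← pencilValue_mul α Φ A hU', ← Matrix.mul_assoc] at h
  obtain ⟨c, hc⟩ := exists_eq_smul_of_pencilValue_eq_zero hK hr hpos (hFK hA)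
    (hpsd A (hFK hA)) (hγ.mul hZ) (hker A hA) h
  rw [← Matrix.smul_mul] at hc
  have hc' := cancel hc
  have hgram : (W * δ')ᴴ * (W * δ') = (U * δ')ᴴ * (U * δ') := by
    simp only [Matrix.conjTranspose_mul, Matrix.mul_assoc]
    rw [← Matrix.mul_assoc Wᴴ, hW, ← Matrix.mul_assoc Uᴴ, hU']
  have hgram' : (W * δ')ᴴ * (W * δ') = (star c * c) • (γᴴ * γ) := by
    rw [hgram, hc', Matrix.conjTranspose_smul, Matrix.smul_mul, Matrix.mul_smul, smul_smul]
  have hcc : star c * c = 1 := by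
    rw [hgram', Matrix.trace_smul, htr] at hδ
    simpa using hδ
  refine ⟨A, hA, Prod.ext ?_ ?_⟩
  · simp only [hgram', hcc, one_smul]
  · simp only [mconj_mul W, hBA]
    rw [← mconj_mul, hc', mconj_smul_of_norm_one c hcc]

end

/-- The continuous exposing functional `(S, T) ↦ -pencilForm (Z*SZ, Z*TZ)`. -/
noncomputable def gammaFunctional [TopologicalSpace V] [IsTopologicalAddGroup V]
    [ContinuousSMul ℂ V] {r : ℕ} (α : Matrix (Fin r) (Fin r) ℂ)
    (Φ : V →L[ℂ] Matrix (Fin r) (Fin r) ℂ) (Z : Matrix (Fin r) (Fin r) ℂ) :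
    Matrix (Fin r) (Fin r) ℂ × Matrix (Fin r) (Fin r) V →L[ℂ] ℂ where
  toFun P := -pencilForm α Φ.toLinearMap (Zᴴ * P.1 * Z, mconj Z P.2)
  map_add' P Q := by
    have : (Zᴴ * (P + Q).1 * Z, mconj Z (P + Q).2) =
        (Zᴴ * P.1 * Z, mconj Z P.2) + (Zᴴ * Q.1 * Z, mconj Z Q.2) := by
      refine Prod.ext ?_ ?_
      · simp [Matrix.mul_add, Matrix.add_mul]
      · ext i j
        simp [mconj, Finset.sum_add_distrib]
    rw [this, map_add, neg_add]
  map_smul' c P := by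
    have : (Zᴴ * (c • P).1 * Z, mconj Z (c • P).2) =
        c • (Zᴴ * P.1 * Z, mconj Z P.2) := by
      refine Prod.ext ?_ ?_
      · simp
      · ext i j
        simp [mconj, Finset.smul_sum, smul_comm c]
    rw [this, map_smul]
    simp
  cont := by
    simp only [pencilForm, mconj, LinearMap.coe_mk, AddHom.coe_mk, Matrix.of_apply,
      ContinuousLinearMap.coe_coe]
    have hT : ∀ k l : Fin r, Continuous
        fun P : Matrix (Fin r) (Fin r) ℂ × Matrix (Fin r) (Fin r) V => P.2 k l :=
      fun k l => continuous_snd.matrix_elem k l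
    have hS : Continuous
        fun P : Matrix (Fin r) (Fin r) ℂ × Matrix (Fin r) (Fin r) V => Zᴴ * P.1 * Z :=
      (continuous_const.matrix_mul continuous_fst).matrix_mul continuous_const
    refine (Continuous.sub ?_ ?_).neg
    · exact continuous_finsetSum _ fun p _ => continuous_finsetSum _ fun q _ =>
        continuous_const.mul (hS.matrix_elem p q)
    · refine continuous_finsetSum _ fun p _ => continuous_finsetSum _ fun q _ => ?_
      refine (Φ.continuous.comp ?_).matrix_elem p q
      exact continuous_finsetSum _ fun a _ => continuous_finsetSum _ fun b _ =>
        (hT a b).const_smul _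

theorem re_gammaFunctional [TopologicalSpace V] [IsTopologicalAddGroup V]
    [ContinuousSMul ℂ V] {r k : ℕ} (α : Matrix (Fin r) (Fin r) ℂ)
    (Φ : V →L[ℂ] Matrix (Fin r) (Fin r) ℂ) (Z : Matrix (Fin r) (Fin r) ℂ)
    (δ : Matrix (Fin k) (Fin r) ℂ) (B : Matrix (Fin k) (Fin k) V) :
    (gammaFunctional α Φ Z (δᴴ * δ, mconj δ B)).re =
      -pencilValue α Φ.toLinearMap B (δ * Z) := by
  rw [pencilValue, mconj_mul, Matrix.conjTranspose_mul, Matrix.mul_assoc, ← Matrix.mul_assoc δᴴ,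
    ← Matrix.mul_assoc Zᴴ]
  rfl

theorem IsWeakMatrixExposedFace.isExposedFaceOf_gammaSet [TopologicalSpace V]
    [IsTopologicalAddGroup V] [ContinuousSMul ℂ V]
    {K : ∀ n : ℕ, Set (Matrix (Fin n) (Fin n) V)} (hK : IsMatrixConvex K)
    {r : ℕ} (hr : 0 < r) {F : Set (Matrix (Fin r) (Fin r) V)}
    (hF : IsWeakMatrixExposedFace K F) {γ : Matrix (Fin r) (Fin r) ℂ} (hγ : IsUnit γ)
    (htr : (γᴴ * γ).trace = 1) :
    IsExposedFaceOf (GammaSet K r) ((fun A => (γᴴ * γ, mconj γ A)) '' F) := by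
  obtain ⟨hFK, hconv, Φ, α, -, hpsd, hpos, hsing⟩ := hF
  have hpsd' : ∀ m : ℕ, 0 < m → ∀ B ∈ K m, (pencil α Φ.toLinearMap B).PosSemidef := hpsd
  have hker : ∀ B ∈ K r, (∃ Y : Matrix (Fin r) (Fin r) ℂ,
      Y ≠ 0 ∧ pencilValue α Φ.toLinearMap B Y = 0) ↔ B ∈ unitaryOrbit F := by
    intro B hB
    simp only [pencilValue_eq_zero_iff (hpsd' r hr B hB), ← not_isUnit_iff_exists_vec]
    rw [← hsing]
    exact ⟨fun h => ⟨hB, hpsd r hr B hB, h⟩, fun h => h.2.2⟩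
  obtain ⟨X, hX, hX0⟩ := exists_common_kernel hK hr hpos hFK hconv (hpsd' r hr) fun A hA =>
    (hker A (hFK hA)).mpr ⟨A, hA, 1, one_mem _, (mconj_one A).symm⟩
  have hZ : IsUnit (γ⁻¹ * X) := IsUnit.mul (by simpa using hγ) hX
  have hγZ : γ * (γ⁻¹ * X) = X :=
    Matrix.mul_nonsing_inv_cancel_left γ X ((Matrix.isUnit_iff_isUnit_det γ).mp hγ)
  refine ⟨?_, gammaFunctional α Φ (γ⁻¹ * X), 0, ?_, ?_⟩
  · rintro _ ⟨A, hA, rfl⟩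
    exact ⟨r, hr, A, γ, hFK hA, htr, rfl⟩
  · rintro _ ⟨A, hA, rfl⟩
    rw [re_gammaFunctional, hγZ, hX0 A hA, neg_zero]
  · rintro _ ⟨k, hk, B, δ, hB, hδ, rfl⟩ hnot
    rw [re_gammaFunctional, neg_lt_zero]
    refine lt_of_le_of_ne (pencilValue_nonneg (hpsd' k hk B hB) _) fun h0 => hnot ?_
    exact mem_image_of_pencilValue_eq_zero hK hr hpos hFK (hpsd' r hr)
      (fun B hB => (hker B hB).mp) htr hγ hZ (by rwa [hγZ]) hk hB hδ h0.symm

end Helpers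

section Statements

variable {E F' : Type*} [AddCommGroup E] [Module ℂ E] [AddCommGroup F'] [Module ℂ F']
theorem weakMatrixExposedFace_implies_gammaExposedFace
    (p : E →ₗ[ℂ] F' →ₗ[ℂ] ℂ)
    (K : ∀ n : ℕ, Set (Matrix (Fin n) (Fin n) (WeakBilin p)))
    (hK : IsMatrixConvex K)
    (r : ℕ) (hr : 0 < r)
    (F : Set (Matrix (Fin r) (Fin r) (WeakBilin p)))
    (hF : IsWeakMatrixExposedFace K F)
    (γ : Matrix (Fin r) (Fin r) ℂ) (hγ : IsUnit γ) (htr : (γᴴ * γ).trace = 1) :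
    IsExposedFaceOf (GammaSet K r) ((fun A => (γᴴ * γ, mconj γ A)) '' F) := by
  exact hF.isExposedFaceOf_gammaSet hK hr hγ htr

end Statements
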